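/- arXiv:1903.01457 — 2 statements merged into one kernel-verified Lean document; each statement's English description precedes it below -/
import Mathlib

section
/- The equation ψ′(x)(1+x) − ψ(x) = 0 has exactly one solution c in the interval (−1, ∞); that is, H is strictly increasing on (−1,∞), H(−1) = −ψ(−1) < 0, H(x) → +∞ as x → +∞, and H has a unique zero c > −1. -/
open Real Filter Set

/-- The increasing fundamental solution ψ for the oscillating Brownian motion with
volatility `σ₁` on `(-∞,0)` and `σ₂` on `(0,∞)`, discount parameter `r`. -/
noncomputable def psi (σ₁ σ₂ r x : ℝ) : ℝ :=
  if x < 0 then Real.exp (Real.sqrt (2*r)/σ₁ * x)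
  else (1 + σ₂/σ₁)/2 * Real.exp (Real.sqrt (2*r)/σ₂ * x)
     + (1 - σ₂/σ₁)/2 * Real.exp (-(Real.sqrt (2*r)/σ₂) * x)

/-- H(x) = ψ′(x)·(1+x) − ψ(x). -/
noncomputable def Hfun (σ₁ σ₂ r x : ℝ) : ℝ :=
  deriv (psi σ₁ σ₂ r) x * (1 + x) - psi σ₁ σ₂ r x

/-- Gluing two differentiable functions with matching value and slope at the junction. -/
theorem hasDerivAt_ite_lt {f g f' g' : ℝ → ℝ} {a : ℝ}
    (hf : ∀ x, HasDerivAt f (f' x) x) (hg : ∀ x, HasDerivAt g (g' x) x)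
    (h : f a = g a) (h' : f' a = g' a) (x : ℝ) :
    HasDerivAt (fun y => if y < a then f y else g y) (if x < a then f' x else g' x) x := by
  rcases lt_trichotomy x a with hx | rfl | hx
  · rw [if_pos hx]
    refine (hf x).congr_of_eventuallyEq ?_
    filter_upwards [Iio_mem_nhds hx] with y hy
    exact if_pos hy
  · rw [if_neg (lt_irrefl x), ← hasDerivWithinAt_univ, ← Iic_union_Ici (a := x)]
    refine HasDerivWithinAt.union ?_ ?_
    · refine (h' ▸ (hf x).hasDerivWithinAt).congr_of_mem (fun y hy => ?_) self_mem_Iic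
      rcases (mem_Iic.1 hy).lt_or_eq with hy | rfl
      · exact if_pos hy
      · simp [h]
    · exact (hg x).hasDerivWithinAt.congr_of_mem
        (fun y hy => if_neg (not_lt.2 hy)) self_mem_Ici
  · rw [if_neg hx.le.not_gt]
    refine (hg x).congr_of_eventuallyEq ?_
    filter_upwards [Ioi_mem_nhds hx] with y hy
    exact if_neg (not_lt.2 (mem_Ioi.1 hy).le)

theorem hasDerivAt_mul_exp_mul (b l x : ℝ) :
    HasDerivAt (fun y => b * exp (l * y)) (b * l * exp (l * x)) x := by
  refine (((hasDerivAt_id x).const_mul l).exp.const_mul b).congr_deriv ?_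
  simp only [id]; ring

theorem hasDerivAt_psi {σ₁ σ₂ : ℝ} (r : ℝ) (hσ₁ : 0 < σ₁) (hσ₂ : 0 < σ₂) (x : ℝ) :
    HasDerivAt (psi σ₁ σ₂ r)
      (if x < 0 then √(2*r)/σ₁ * exp (√(2*r)/σ₁ * x)
        else (1 + σ₂/σ₁)/2 * (√(2*r)/σ₂) * exp (√(2*r)/σ₂ * x)
          + (1 - σ₂/σ₁)/2 * (-(√(2*r)/σ₂)) * exp (-(√(2*r)/σ₂) * x)) x := by
  refine hasDerivAt_ite_lt (a := 0)
    (fun y => by simpa only [one_mul] using hasDerivAt_mul_exp_mul 1 (√(2*r)/σ₁) y)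
    (fun y => (hasDerivAt_mul_exp_mul _ _ y).add (hasDerivAt_mul_exp_mul _ _ y)) ?_ ?_ x
  · simp; ring
  · simp; field_simp; ring

/-- The derivative of `x ↦ b l e^{lx} (1 + x) - b e^{lx}`. -/
theorem hasDerivAt_exp_branch (b l x : ℝ) :
    HasDerivAt (fun y => b * l * exp (l * y) * (1 + y) - b * exp (l * y))
      (l ^ 2 * (b * exp (l * x)) * (1 + x)) x := by
  refine (((hasDerivAt_mul_exp_mul (b * l) l x).mul ((hasDerivAt_id x).const_add 1)).sub
    (hasDerivAt_mul_exp_mul b l x)).congr_deriv ?_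
  simp only [id]; ring

theorem one_le_branch {k t : ℝ} (hk : 0 ≤ k) (ht : 0 ≤ t) :
    1 ≤ (1 + k)/2 * exp t + (1 - k)/2 * exp (-t) := by
  have hc := one_le_cosh t
  have hs := mul_nonneg hk (sinh_nonneg_iff.2 ht)
  rw [cosh_eq] at hc
  rw [sinh_eq] at hs
  linarith

theorem psi_pos_of_neg (σ₁ σ₂ r : ℝ) {x : ℝ} (hx : x < 0) : 0 < psi σ₁ σ₂ r x := by
  rw [psi, if_pos hx]; positivity

theorem Hfun_eq_ite {σ₁ σ₂ : ℝ} (r : ℝ) (hσ₁ : 0 < σ₁) (hσ₂ : 0 < σ₂) (x : ℝ) :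
    Hfun σ₁ σ₂ r x =
      if x < 0 then
        1 * (√(2*r)/σ₁) * exp (√(2*r)/σ₁ * x) * (1 + x) - 1 * exp (√(2*r)/σ₁ * x)
      else
        ((1 + σ₂/σ₁)/2 * (√(2*r)/σ₂) * exp (√(2*r)/σ₂ * x) * (1 + x)
          - (1 + σ₂/σ₁)/2 * exp (√(2*r)/σ₂ * x))
        + ((1 - σ₂/σ₁)/2 * (-(√(2*r)/σ₂)) * exp (-(√(2*r)/σ₂) * x) * (1 + x)
          - (1 - σ₂/σ₁)/2 * exp (-(√(2*r)/σ₂) * x)) := by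
  rw [Hfun, (hasDerivAt_psi r hσ₁ hσ₂ x).deriv, psi]
  split_ifs <;> ring

/-- The functions ψ and its derivative are continuous, hence so is H. -/
theorem continuous_Hfun {σ₁ σ₂ : ℝ} (r : ℝ) (hσ₁ : 0 < σ₁) (hσ₂ : 0 < σ₂) :
    Continuous (Hfun σ₁ σ₂ r) := by
  have hψ : Continuous (psi σ₁ σ₂ r) :=
    continuous_iff_continuousAt.2 fun x => (hasDerivAt_psi r hσ₁ hσ₂ x).continuousAt
  have hψ' : Continuous (deriv (psi σ₁ σ₂ r)) := by
    rw [funext fun x => (hasDerivAt_psi r hσ₁ hσ₂ x).deriv]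
    simp only [← not_le, ite_not]
    refine Continuous.if_le (by fun_prop) (by fun_prop) continuous_const continuous_id ?_
    rintro x rfl
    simp; field_simp; ring
  unfold Hfun
  fun_prop

theorem strictMonoOn_Hfun_Icc {σ₁ σ₂ r : ℝ} (hσ₁ : 0 < σ₁) (hσ₂ : 0 < σ₂) (hr : 0 < r) :
    StrictMonoOn (Hfun σ₁ σ₂ r) (Icc (-1) 0) := by
  refine strictMonoOn_of_hasDerivWithinAt_pos (convex_Icc _ _)
    (continuous_Hfun r hσ₁ hσ₂).continuousOn
    (f' := fun x => (√(2*r)/σ₁) ^ 2 * (1 * exp (√(2*r)/σ₁ * x)) * (1 + x)) ?_ ?_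
  · intro x hx
    rw [interior_Icc] at hx
    refine ((hasDerivAt_exp_branch 1 (√(2*r)/σ₁) x).congr_of_eventuallyEq
      ?_).hasDerivWithinAt
    filter_upwards [Iio_mem_nhds hx.2] with y hy
    rw [Hfun_eq_ite r hσ₁ hσ₂, if_pos (mem_Iio.1 hy)]
  · intro x hx
    rw [interior_Icc] at hx
    have : 0 < 1 + x := by linarith [hx.1]
    positivity

/-- On the nonnegative half-line the slope of H is at least `(√(2*r)/σ₂) ^ 2`. -/
theorem monotoneOn_Hfun_sub {σ₁ σ₂ : ℝ} (r : ℝ) (hσ₁ : 0 < σ₁) (hσ₂ : 0 < σ₂) :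
    MonotoneOn (fun x => Hfun σ₁ σ₂ r x - (√(2*r)/σ₂) ^ 2 * x) (Ici 0) := by
  have hcont := continuous_Hfun r hσ₁ hσ₂
  refine monotoneOn_of_hasDerivWithinAt_nonneg (convex_Ici _)
    (Continuous.continuousOn (by fun_prop))
    (f' := fun x => (√(2*r)/σ₂) ^ 2 * ((1 + σ₂/σ₁)/2 * exp (√(2*r)/σ₂ * x)) * (1 + x)
      + (-(√(2*r)/σ₂)) ^ 2 * ((1 - σ₂/σ₁)/2 * exp (-(√(2*r)/σ₂) * x)) * (1 + x)
      - (√(2*r)/σ₂) ^ 2 * 1) ?_ ?_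
  · intro x hx
    rw [interior_Ici] at hx
    refine HasDerivAt.hasDerivWithinAt (HasDerivAt.sub ?_ ((hasDerivAt_id x).const_mul _))
    refine ((hasDerivAt_exp_branch _ _ x).add
      (hasDerivAt_exp_branch _ _ x)).congr_of_eventuallyEq ?_
    filter_upwards [Ioi_mem_nhds hx] with y hy
    rw [Hfun_eq_ite r hσ₁ hσ₂, if_neg (not_lt.2 (mem_Ioi.1 hy).le)]
    rfl
  · intro x hx
    rw [interior_Ici] at hx
    have hx : 0 < x := hx
    have hψ := one_le_branch (k := σ₂/σ₁) (t := √(2*r)/σ₂ * x) (by positivity) (by positivity)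
    rw [← neg_mul] at hψ
    have h := mul_nonneg (sq_nonneg (√(2*r)/σ₂))
      (sub_nonneg.2 (one_le_mul_of_one_le_of_one_le hψ (by linarith : 1 ≤ 1 + x)))
    linarith

theorem strictMonoOn_Hfun_Ici {σ₁ σ₂ r : ℝ} (hσ₁ : 0 < σ₁) (hσ₂ : 0 < σ₂) (hr : 0 < r) :
    StrictMonoOn (Hfun σ₁ σ₂ r) (Ici 0) := by
  intro x hx y hy hxy
  have h := monotoneOn_Hfun_sub r hσ₁ hσ₂ hx hy hxy.le
  have h' : (√(2*r)/σ₂) ^ 2 * x < (√(2*r)/σ₂) ^ 2 * y := by gcongr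
  simp only at h
  linarith

theorem tendsto_Hfun_atTop {σ₁ σ₂ r : ℝ} (hσ₁ : 0 < σ₁) (hσ₂ : 0 < σ₂) (hr : 0 < r) :
    Tendsto (Hfun σ₁ σ₂ r) atTop atTop := by
  have hl : 0 < (√(2*r)/σ₂) ^ 2 := by positivity
  refine tendsto_atTop_mono' _ ?_
    (tendsto_atTop_add_const_left _ (Hfun σ₁ σ₂ r 0) (tendsto_id.const_mul_atTop hl))
  filter_upwards [eventually_ge_atTop 0] with x hx
  have h := monotoneOn_Hfun_sub r hσ₁ hσ₂ self_mem_Ici hx hx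
  simp only [mul_zero, sub_zero] at h
  simp only [id]
  linarith

/-- H is strictly increasing on (−1,∞), H(−1) = −ψ(−1) < 0, H(x)→+∞ as x→+∞,
and H has a unique zero c > −1. -/
theorem stmt_4 (σ₁ σ₂ r : ℝ) (hσ₁ : 0 < σ₁) (hσ₂ : 0 < σ₂) (hr : 0 < r) :
    StrictMonoOn (Hfun σ₁ σ₂ r) (Set.Ioi (-1)) ∧
    Hfun σ₁ σ₂ r (-1) = -psi σ₁ σ₂ r (-1) ∧
    Hfun σ₁ σ₂ r (-1) < 0 ∧
    Tendsto (Hfun σ₁ σ₂ r) atTop atTop ∧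
    (∃! c : ℝ, -1 < c ∧ Hfun σ₁ σ₂ r c = 0) := by
  have hmono : StrictMonoOn (Hfun σ₁ σ₂ r) (Ici (-1)) := by
    rw [← Icc_union_Ici_eq_Ici (show (-1 : ℝ) ≤ 0 by norm_num)]
    exact (strictMonoOn_Hfun_Icc hσ₁ hσ₂ hr).union (strictMonoOn_Hfun_Ici hσ₁ hσ₂ hr)
      (isGreatest_Icc (by norm_num)) isLeast_Ici
  have heq : Hfun σ₁ σ₂ r (-1) = -psi σ₁ σ₂ r (-1) := by simp [Hfun]
  have hneg : Hfun σ₁ σ₂ r (-1) < 0 := by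
    rw [heq, neg_lt_zero]
    exact psi_pos_of_neg σ₁ σ₂ r (by norm_num)
  have htop := tendsto_Hfun_atTop hσ₁ hσ₂ hr
  refine ⟨hmono.mono Ioi_subset_Ici_self, heq, hneg, htop, ?_⟩
  obtain ⟨M, hM, hM1⟩ := ((htop.eventually_ge_atTop 0).and (eventually_ge_atTop (-1))).exists
  obtain ⟨c, hc, hc0⟩ :=
    intermediate_value_Icc hM1 (continuous_Hfun r hσ₁ hσ₂).continuousOn ⟨hneg.le, hM⟩
  refine ⟨c, ⟨hc.1.lt_of_ne ?_, hc0⟩, fun d hd => ?_⟩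
  · rintro rfl
    exact hneg.ne hc0
  · exact hmono.injOn hd.1.le hc.1 (hd.2.trans hc0.symm)
end

section
/- Assume 0 < σ₁² ≤ σ₂² ≤ 2σ₁², and for each r > 0 let c(r) be the unique zero in (−1,∞) of the function G associated with discount parameter r. Then the map r ↦ c(r) is non-increasing on (0,∞), c(r) → +∞ as r → 0⁺, and c(r) → −1 as r → +∞. -/
open Real Filter Set

/-- G(x) = ψ′(x)·(1+x)² − 2·ψ(x)·(1+x). -/
noncomputable def Gfun (σ₁ σ₂ r x : ℝ) : ℝ :=
  deriv (psi σ₁ σ₂ r) x * (1 + x)^2 - 2 * psi σ₁ σ₂ r x * (1 + x)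

/-- The derivative of `psi` with respect to `x`. -/
noncomputable def psiDeriv (σ₁ σ₂ r x : ℝ) : ℝ :=
  if 0 ≤ x then √(2*r)/σ₂ * (sinh (√(2*r)/σ₂ * x) + σ₂/σ₁ * cosh (√(2*r)/σ₂ * x))
  else √(2*r)/σ₁ * exp (√(2*r)/σ₁ * x)

lemma psi_of_neg (σ₁ σ₂ r : ℝ) {x : ℝ} (hx : x < 0) :
    psi σ₁ σ₂ r x = exp (√(2*r)/σ₁ * x) := by
  simp [psi, hx]

lemma psi_of_nonneg (σ₁ σ₂ r : ℝ) {x : ℝ} (hx : 0 ≤ x) :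
    psi σ₁ σ₂ r x = cosh (√(2*r)/σ₂ * x) + σ₂/σ₁ * sinh (√(2*r)/σ₂ * x) := by
  rw [psi, if_neg hx.not_gt, cosh_eq, sinh_eq, neg_mul]
  ring

lemma psiDeriv_of_neg (σ₁ σ₂ r : ℝ) {x : ℝ} (hx : x < 0) :
    psiDeriv σ₁ σ₂ r x = √(2*r)/σ₁ * exp (√(2*r)/σ₁ * x) := by
  rw [psiDeriv, if_neg hx.not_ge]

lemma psiDeriv_of_nonneg (σ₁ σ₂ r : ℝ) {x : ℝ} (hx : 0 ≤ x) :
    psiDeriv σ₁ σ₂ r x =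
      √(2*r)/σ₂ * (sinh (√(2*r)/σ₂ * x) + σ₂/σ₁ * cosh (√(2*r)/σ₂ * x)) := by
  rw [psiDeriv, if_pos hx]

lemma hasDerivAt_exp_const_mul (a x : ℝ) :
    HasDerivAt (fun y => exp (a * y)) (a * exp (a * x)) x := by
  have h := ((hasDerivAt_id x).const_mul a).exp
  simpa [mul_comm] using h

lemma hasDerivAt_cosh_add_sinh (b k x : ℝ) :
    HasDerivAt (fun y => cosh (b * y) + k * sinh (b * y))
      (b * (sinh (b * x) + k * cosh (b * x))) x := by
  have h0 : HasDerivAt (fun y => b * y) b x := by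
    simpa using (hasDerivAt_id x).const_mul b
  have h := h0.cosh.add (h0.sinh.const_mul k)
  refine h.congr_deriv ?_
  ring

lemma hasDerivAt_psi_s13 {σ₁ σ₂ : ℝ} (hσ₂ : σ₂ ≠ 0) (r x : ℝ) :
    HasDerivAt (psi σ₁ σ₂ r) (psiDeriv σ₁ σ₂ r x) x := by
  rcases lt_trichotomy x 0 with hx | rfl | hx
  · rw [psiDeriv_of_neg _ _ _ hx]
    refine (hasDerivAt_exp_const_mul _ x).congr_of_eventuallyEq ?_
    filter_upwards [Iio_mem_nhds hx] with y hy using psi_of_neg _ _ _ hy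
  · have hl : HasDerivWithinAt (psi σ₁ σ₂ r) (psiDeriv σ₁ σ₂ r 0) (Iic 0) 0 := by
      have h := (hasDerivAt_exp_const_mul (√(2*r)/σ₁) 0).hasDerivWithinAt (s := Iic 0)
      refine (h.congr (fun y hy => ?_) ?_).congr_deriv ?_
      · rcases (show y ≤ 0 from hy).lt_or_eq with hy | rfl
        · exact psi_of_neg _ _ _ hy
        · simp [psi_of_nonneg]
      · simp [psi_of_nonneg]
      · rw [psiDeriv_of_nonneg _ _ _ le_rfl]
        simp
        field_simp
    have hr : HasDerivWithinAt (psi σ₁ σ₂ r) (psiDeriv σ₁ σ₂ r 0) (Ici 0) 0 := by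
      rw [psiDeriv_of_nonneg _ _ _ le_rfl]
      have h := (hasDerivAt_cosh_add_sinh (√(2*r)/σ₂) (σ₂/σ₁) 0).hasDerivWithinAt (s := Ici 0)
      exact h.congr (fun y hy => psi_of_nonneg _ _ _ hy) (psi_of_nonneg _ _ _ le_rfl)
    simpa [Iic_union_Ici] using hl.union hr
  · rw [psiDeriv_of_nonneg _ _ _ hx.le]
    refine (hasDerivAt_cosh_add_sinh _ _ x).congr_of_eventuallyEq ?_
    filter_upwards [Ioi_mem_nhds hx] with y hy using psi_of_nonneg _ _ _ (le_of_lt hy)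

lemma continuous_psiDeriv {σ₁ σ₂ : ℝ} (hσ₂ : σ₂ ≠ 0) (r : ℝ) :
    Continuous (psiDeriv σ₁ σ₂ r) := by
  unfold psiDeriv
  refine Continuous.if_le ?_ ?_ continuous_const continuous_id ?_
  · fun_prop
  · fun_prop
  · rintro x rfl
    simp
    field_simp

lemma Gfun_eq {σ₁ σ₂ : ℝ} (hσ₂ : σ₂ ≠ 0) (r x : ℝ) :
    Gfun σ₁ σ₂ r x = (1 + x) * (psiDeriv σ₁ σ₂ r x * (1 + x) - 2 * psi σ₁ σ₂ r x) := by
  rw [Gfun, (hasDerivAt_psi_s13 hσ₂ r x).deriv]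
  ring

lemma continuous_Gfun {σ₁ σ₂ : ℝ} (hσ₂ : σ₂ ≠ 0) (r : ℝ) : Continuous (Gfun σ₁ σ₂ r) := by
  have h1 := continuous_psiDeriv (σ₁ := σ₁) hσ₂ r
  have h2 : Continuous (psi σ₁ σ₂ r) :=
    continuous_iff_continuousAt.2 fun x => (hasDerivAt_psi_s13 hσ₂ r x).continuousAt
  rw [funext (Gfun_eq hσ₂ r)]
  fun_prop

lemma cosh_add_mul_sinh_pos {k u : ℝ} (hk : 0 ≤ k) (hu : 0 ≤ u) : 0 < cosh u + k * sinh u :=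
  add_pos_of_pos_of_nonneg (cosh_pos u) (mul_nonneg hk (sinh_nonneg_iff.2 hu))

lemma psi_pos {σ₁ σ₂ : ℝ} (hσ₁ : 0 < σ₁) (hσ₂ : 0 < σ₂) (r x : ℝ) : 0 < psi σ₁ σ₂ r x := by
  rcases lt_or_ge x 0 with hx | hx
  · rw [psi_of_neg _ _ _ hx]
    exact exp_pos _
  · rw [psi_of_nonneg _ _ _ hx]
    exact cosh_add_mul_sinh_pos (by positivity) (by positivity)

lemma psiDeriv_le {σ₁ σ₂ : ℝ} (hσ₁ : 0 < σ₁) (h : σ₁ ≤ σ₂) (r x : ℝ) :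
    psiDeriv σ₁ σ₂ r x ≤ √(2*r)/σ₁ * psi σ₁ σ₂ r x := by
  have hσ₂ : 0 < σ₂ := hσ₁.trans_le h
  rcases lt_or_ge x 0 with hx | hx
  · rw [psi_of_neg _ _ _ hx, psiDeriv_of_neg _ _ _ hx]
  · rw [psi_of_nonneg _ _ _ hx, psiDeriv_of_nonneg _ _ _ hx]
    have hk : 1 ≤ σ₂/σ₁ := (one_le_div hσ₁).2 h
    have hs : 0 ≤ sinh (√(2*r)/σ₂ * x) := sinh_nonneg_iff.2 (by positivity)
    have e : √(2*r)/σ₁ = √(2*r)/σ₂ * (σ₂/σ₁) := by field_simp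
    rw [e, mul_assoc]
    refine mul_le_mul_of_nonneg_left ?_ (by positivity)
    nlinarith [mul_nonneg (mul_nonneg (sub_nonneg.2 hk) (by linarith : 0 ≤ σ₂/σ₁ + 1)) hs]

lemma le_psiDeriv {σ₁ σ₂ : ℝ} (hσ₁ : 0 < σ₁) (h : σ₁ ≤ σ₂) (r x : ℝ) :
    √(2*r)/σ₂ * psi σ₁ σ₂ r x ≤ psiDeriv σ₁ σ₂ r x := by
  have hσ₂ : 0 < σ₂ := hσ₁.trans_le h
  rcases lt_or_ge x 0 with hx | hx
  · rw [psi_of_neg _ _ _ hx, psiDeriv_of_neg _ _ _ hx]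
    gcongr
  · rw [psi_of_nonneg _ _ _ hx, psiDeriv_of_nonneg _ _ _ hx]
    have hk : 1 ≤ σ₂/σ₁ := (one_le_div hσ₁).2 h
    have hs : sinh (√(2*r)/σ₂ * x) ≤ cosh (√(2*r)/σ₂ * x) := (sinh_lt_cosh _).le
    refine mul_le_mul_of_nonneg_left ?_ (by positivity)
    nlinarith [mul_nonneg (sub_nonneg.2 hk) (sub_nonneg.2 hs)]

/-- The map `u ↦ u (sinh u + k cosh u) / (cosh u + k sinh u)` is non-decreasing on `[0, ∞)`. -/
lemma monotoneOn_mul_sinh_add_div {k : ℝ} (hk : 1 ≤ k) :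
    MonotoneOn (fun u => u * (sinh u + k * cosh u) / (cosh u + k * sinh u)) (Ici 0) := by
  have hd : ∀ u : ℝ, 0 ≤ u → HasDerivAt
      (fun u => u * (sinh u + k * cosh u) / (cosh u + k * sinh u))
      (((1 * (sinh u + k * cosh u) + u * (cosh u + k * sinh u)) * (cosh u + k * sinh u) -
        u * (sinh u + k * cosh u) * (sinh u + k * cosh u)) / (cosh u + k * sinh u) ^ 2) u :=
    fun u hu => ((hasDerivAt_id u).mul
      ((hasDerivAt_sinh u).add ((hasDerivAt_cosh u).const_mul k))).div
      ((hasDerivAt_cosh u).add ((hasDerivAt_sinh u).const_mul k))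
      (cosh_add_mul_sinh_pos (by linarith) hu).ne'
  refine monotoneOn_of_deriv_nonneg (convex_Ici 0)
    (fun u hu => (hd u hu).continuousAt.continuousWithinAt)
    (fun u hu => (hd u (interior_subset hu)).differentiableAt.differentiableWithinAt) ?_
  intro u hu
  have hu0 : 0 ≤ u := interior_subset hu
  rw [(hd u hu0).deriv]
  refine div_nonneg ?_ (sq_nonneg _)
  have hs : u ≤ sinh u := self_le_sinh_iff.2 hu0
  have hc : 1 ≤ cosh u := one_le_cosh u
  have hsq : cosh u ^ 2 = sinh u ^ 2 + 1 := by linarith [cosh_sq u]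
  have hsc : u ≤ sinh u * cosh u := by nlinarith
  have h0 : 0 ≤ k * (sinh u ^ 2 + cosh u ^ 2) := by positivity
  have h1 : 0 ≤ (k ^ 2 - 1) * (sinh u * cosh u - u) :=
    mul_nonneg (by nlinarith) (by linarith)
  have h2 : 0 ≤ sinh u * cosh u := by linarith
  have e : (1 * (sinh u + k * cosh u) + u * (cosh u + k * sinh u)) * (cosh u + k * sinh u) -
        u * (sinh u + k * cosh u) * (sinh u + k * cosh u) =
      (k ^ 2 - 1) * (sinh u * cosh u - u) + k * (sinh u ^ 2 + cosh u ^ 2)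
        + 2 * (sinh u * cosh u) := by
    linear_combination u * (1 - k ^ 2) * hsq
  rw [e]
  linarith

/-- The logarithmic derivative of `psi` is non-decreasing in the discount parameter. -/
lemma psiDeriv_div_psi_le {σ₁ σ₂ : ℝ} (hσ₁ : 0 < σ₁) (h : σ₁ ≤ σ₂) {r r' : ℝ} (hr : r ≤ r')
    (x : ℝ) :
    psiDeriv σ₁ σ₂ r x / psi σ₁ σ₂ r x ≤ psiDeriv σ₁ σ₂ r' x / psi σ₁ σ₂ r' x := by
  have hσ₂ : 0 < σ₂ := hσ₁.trans_le h
  have hs : √(2*r) ≤ √(2*r') := Real.sqrt_le_sqrt (by linarith)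
  rcases lt_trichotomy x 0 with hx | rfl | hx
  · simp only [psi_of_neg _ _ _ hx, psiDeriv_of_neg _ _ _ hx,
      mul_div_cancel_right₀ _ (exp_pos _).ne']
    gcongr
  · simp only [psi_of_nonneg _ _ _ le_rfl, psiDeriv_of_nonneg _ _ _ le_rfl, mul_zero, sinh_zero,
      cosh_zero, zero_add, add_zero, mul_one, div_one]
    gcongr
  · have hk : 1 ≤ σ₂/σ₁ := (one_le_div hσ₁).2 h
    have key := monotoneOn_mul_sinh_add_div hk
      (show √(2*r)/σ₂ * x ∈ Ici 0 from mem_Ici.2 (by positivity))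
      (show √(2*r')/σ₂ * x ∈ Ici 0 from mem_Ici.2 (by positivity)) (by gcongr)
    rw [psi_of_nonneg _ _ _ hx.le, psiDeriv_of_nonneg _ _ _ hx.le, psi_of_nonneg _ _ _ hx.le,
      psiDeriv_of_nonneg _ _ _ hx.le]
    refine le_of_mul_le_mul_left ?_ hx
    convert key using 1 <;> ring

/-- Assume 0 < σ₁² ≤ σ₂² ≤ 2σ₁² and for each r > 0 let c(r) be the unique zero of
G (with parameter r) in (−1,∞). Then r ↦ c(r) is non-increasing on (0,∞),
c(r) → +∞ as r → 0⁺, and c(r) → −1 as r → +∞. -/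
theorem stmt_13 (σ₁ σ₂ : ℝ) (hσ₁ : 0 < σ₁) (hσ₂ : 0 < σ₂)
    (h12 : σ₁^2 ≤ σ₂^2) (h21 : σ₂^2 ≤ 2*σ₁^2)
    (c : ℝ → ℝ)
    (hc : ∀ r > (0:ℝ), -1 < c r ∧ Gfun σ₁ σ₂ r (c r) = 0)
    (huniq : ∀ r > (0:ℝ), ∀ y : ℝ, -1 < y → Gfun σ₁ σ₂ r y = 0 → y = c r) :
    AntitoneOn c (Set.Ioi 0) ∧
    Tendsto c (nhdsWithin 0 (Set.Ioi 0)) atTop ∧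
    Tendsto c atTop (nhds (-1)) := by
  have h : σ₁ ≤ σ₂ := (sq_le_sq₀ hσ₁.le hσ₂.le).1 h12
  have hpos : ∀ r > (0:ℝ), 0 < √(2*r) := fun r hr => Real.sqrt_pos.2 (by linarith)
  have hzero : ∀ r > (0:ℝ), psiDeriv σ₁ σ₂ r (c r) * (1 + c r) = 2 * psi σ₁ σ₂ r (c r) := by
    intro r hr
    obtain ⟨h1, h2⟩ := hc r hr
    rw [Gfun_eq hσ₂.ne'] at h2
    rcases mul_eq_zero.1 h2 with h3 | h3 <;> linarith
  have hlow : ∀ r > (0:ℝ), 2 * σ₁ / √(2*r) - 1 ≤ c r := by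
    intro r hr
    have hp := psi_pos hσ₁ hσ₂ r (c r)
    have h1 := mul_le_mul_of_nonneg_right (psiDeriv_le hσ₁ h r (c r))
      (by linarith [(hc r hr).1] : 0 ≤ 1 + c r)
    rw [hzero r hr, mul_right_comm] at h1
    have h2 := le_of_mul_le_mul_right h1 hp
    rw [div_mul_eq_mul_div, le_div_iff₀ hσ₁] at h2
    rw [sub_le_iff_le_add, div_le_iff₀ (hpos r hr)]
    linarith
  have hupp : ∀ r > (0:ℝ), c r ≤ 2 * σ₂ / √(2*r) - 1 := by
    intro r hr
    have hp := psi_pos hσ₁ hσ₂ r (c r)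
    have h1 := mul_le_mul_of_nonneg_right (le_psiDeriv hσ₁ h r (c r))
      (by linarith [(hc r hr).1] : 0 ≤ 1 + c r)
    rw [hzero r hr, mul_right_comm] at h1
    have h2 := le_of_mul_le_mul_right h1 hp
    rw [div_mul_eq_mul_div, div_le_iff₀ hσ₂] at h2
    rw [le_sub_iff_add_le, le_div_iff₀ (hpos r hr)]
    linarith
  refine ⟨?_, ?_, ?_⟩
  · intro r hr r' hr' hrr
    rw [mem_Ioi] at hr hr'
    have hc1 := (hc r hr).1
    have hs := hpos r' hr'
    have hG : 0 ≤ Gfun σ₁ σ₂ r' (c r) := by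
      have hp := psi_pos hσ₁ hσ₂ r (c r)
      have hp' := psi_pos hσ₁ hσ₂ r' (c r)
      have h1 := mul_le_mul_of_nonneg_right (psiDeriv_div_psi_le hσ₁ h hrr (c r))
        (by linarith : 0 ≤ 1 + c r)
      rw [div_mul_eq_mul_div, hzero r hr, mul_div_cancel_right₀ _ hp.ne', div_mul_eq_mul_div,
        le_div_iff₀ hp'] at h1
      rw [Gfun_eq hσ₂.ne']
      exact mul_nonneg (by linarith) (by linarith)
    obtain ⟨y, hy1, hyc, hyb⟩ : ∃ y, -1 < y ∧ y ≤ c r ∧ y ≤ 2 * σ₁ / √(2*r') - 1 := by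
      refine ⟨min (c r) (2 * σ₁ / √(2*r') - 1), lt_min hc1 ?_, min_le_left _ _, min_le_right _ _⟩
      have : 0 < 2 * σ₁ / √(2*r') := by positivity
      linarith
    have hGy : Gfun σ₁ σ₂ r' y ≤ 0 := by
      have hp := psi_pos hσ₁ hσ₂ r' y
      have h1 := mul_le_mul_of_nonneg_right (psiDeriv_le hσ₁ h r' y)
        (by linarith : 0 ≤ 1 + y)
      have h2 : √(2*r')/σ₁ * (1 + y) ≤ 2 := by
        rw [le_sub_iff_add_le, le_div_iff₀ hs] at hyb
        rw [div_mul_eq_mul_div, div_le_iff₀ hσ₁]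
        linarith
      have h3 := mul_le_mul_of_nonneg_right h2 hp.le
      rw [mul_right_comm] at h1
      rw [Gfun_eq hσ₂.ne']
      exact mul_nonpos_of_nonneg_of_nonpos (by linarith) (by linarith)
    obtain ⟨z, hz, hz0⟩ := intermediate_value_Icc hyc (continuous_Gfun hσ₂.ne' r').continuousOn
      ⟨hGy, hG⟩
    rw [← huniq r' hr' z (hy1.trans_le hz.1) hz0]
    exact hz.2
  · have hsq : Tendsto (fun r : ℝ => √(2*r)) (nhdsWithin 0 (Ioi 0)) (nhdsWithin 0 (Ioi 0)) := by
      refine tendsto_nhdsWithin_iff.2 ⟨?_, ?_⟩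
      · have hcont : Continuous fun r : ℝ => √(2*r) := by fun_prop
        simpa using (hcont.tendsto 0).mono_left nhdsWithin_le_nhds
      · filter_upwards [self_mem_nhdsWithin] with r hr using hpos r hr
    have h1 := (hsq.inv_tendsto_nhdsGT_zero.const_mul_atTop (by positivity : 0 < 2 * σ₁))
    refine tendsto_atTop_mono' _ ?_ (tendsto_atTop_add_const_right _ (-1) h1)
    filter_upwards [self_mem_nhdsWithin] with r hr using hlow r hr
  · have hsq : Tendsto (fun r : ℝ => √(2*r)) atTop atTop :=
      tendsto_sqrt_atTop.comp (tendsto_id.const_mul_atTop two_pos)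
    have h1 : Tendsto (fun r : ℝ => 2 * σ₂ / √(2*r) - 1) atTop (nhds (-1)) := by
      simpa using (hsq.const_div_atTop (2 * σ₂)).sub_const 1
    refine tendsto_of_tendsto_of_tendsto_of_le_of_le' tendsto_const_nhds h1 ?_ ?_
    · filter_upwards [eventually_gt_atTop 0] with r hr using (hc r hr).1.le
    · filter_upwards [eventually_gt_atTop 0] with r hr using hupp r hr
end
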